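/- Consider the zero-one program: minimise ∑_{i=1}^n c_i x_i subject to ∑_{j=1}^n a_{ij} x_j ≥ b_i for i = 1,…,m and x_i ∈ {0,1}. Let X be a feasible solution and let K ≥ 1. If x* is an optimal solution of NSOP (x* is NSOP-feasible and has objective value ≤ that of every NSOP-feasible vector), then x* attains the minimum objective value among all feasible solutions y of the original program whose Hamming distance from X lies between 1 and K and whose objective value is strictly smaller than that of X. -/

import Mathlib

/-- Feasibility for the original zero-one program. -/
def Feasible (n m : ℕ) (a : Fin m → Fin n → ℤ) (b : Fin m → ℤ)
    (x : Fin n → ℤ) : Prop :=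
  (∀ i, x i = 0 ∨ x i = 1) ∧ (∀ i, ∑ j, a i j * x j ≥ b i)

/-- Feasibility for the Neighbourhood Search Optimisation Programme. -/
def NSOPFeasible (n m : ℕ) (c : Fin n → ℤ) (a : Fin m → Fin n → ℤ)
    (b : Fin m → ℤ) (X : Fin n → ℤ) (K : ℤ) (x : Fin n → ℤ) : Prop :=
  Feasible n m a b x ∧
    1 ≤ (∑ i ∈ Finset.univ.filter (fun i => X i = 0), x i) +
      (∑ i ∈ Finset.univ.filter (fun i => X i = 1), (1 - x i)) ∧
    (∑ i ∈ Finset.univ.filter (fun i => X i = 0), x i) +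
      (∑ i ∈ Finset.univ.filter (fun i => X i = 1), (1 - x i)) ≤ K ∧
    (∑ i, c i * x i) ≤ (∑ i, c i * X i) - 1

/-- On binary vectors the NSOP neighbourhood expression is the Hamming distance. -/
theorem hamming_eq {n : ℕ} (X x : Fin n → ℤ) (hX : ∀ i, X i = 0 ∨ X i = 1)
    (hx : ∀ i, x i = 0 ∨ x i = 1) :
    (∑ i ∈ Finset.univ.filter (fun i => X i = 0), x i) +
      (∑ i ∈ Finset.univ.filter (fun i => X i = 1), (1 - x i)) = ∑ i, |x i - X i| := by
  rw [Finset.sum_filter, Finset.sum_filter, ← Finset.sum_add_distrib]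
  refine Finset.sum_congr rfl fun i _ => ?_
  rcases hX i with h | h <;> rcases hx i with h' | h' <;> simp [h, h']

theorem nsop_optimum_is_neighbourhood_optimum (n m : ℕ) (c : Fin n → ℤ)
    (a : Fin m → Fin n → ℤ) (b : Fin m → ℤ) (X : Fin n → ℤ) (K : ℤ)
    (hXfeas : Feasible n m a b X) (hK : 1 ≤ K)
    (xs : Fin n → ℤ)
    (hxs : NSOPFeasible n m c a b X K xs)
    (hopt : ∀ x, NSOPFeasible n m c a b X K x →
      (∑ i, c i * xs i) ≤ (∑ i, c i * x i)) :
    (Feasible n m a b xs ∧ 1 ≤ (∑ i, |xs i - X i|) ∧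
      (∑ i, |xs i - X i|) ≤ K ∧ (∑ i, c i * xs i) < (∑ i, c i * X i)) ∧
    ∀ y, Feasible n m a b y → 1 ≤ (∑ i, |y i - X i|) →
      (∑ i, |y i - X i|) ≤ K → (∑ i, c i * y i) < (∑ i, c i * X i) →
      (∑ i, c i * xs i) ≤ (∑ i, c i * y i) := by
  obtain ⟨hf, h1, h2, h3⟩ := hxs
  rw [hamming_eq X xs hXfeas.1 hf.1] at h1 h2
  refine ⟨⟨hf, h1, h2, by linarith⟩, fun y hy hy1 hy2 hy3 => hopt y ⟨hy, ?_, ?_, by linarith⟩⟩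
  · rwa [hamming_eq X y hXfeas.1 hy.1]
  · rwa [hamming_eq X y hXfeas.1 hy.1]
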